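/- The outcomes of profiles in which player i plays an admissible strategy are exactly the runs of the game satisfying Φ_i = G(E_i) ∧ (GF(V_{i,1}) → φ_i) ∧ (GF(V_{i,0}) → (φ_i ∨ GF(H_i))): that is, Out_G ∩ Φ_i = Out_G(Adm_i, Σ_{-i}). -/

import Mathlib

open scoped Classical

structure Arena (ι : Type) where
  State : Type
  Act : Type
  init : State
  owner : State → ι
  δ : State → Act → State

namespace Arena

variable {ι : Type} (A : Arena ι)

abbrev Strategy : Type := List A.State → A.Act

abbrev Profile : Type := ι → A.Strategy

def stepsFrom (σ : A.Profile) (s : A.State) : ℕ → A.State × List A.State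
  | 0 => (s, [s])
  | n + 1 =>
    let p := stepsFrom σ s n
    let t := A.δ p.1 (σ (A.owner p.1) p.2)
    (t, t :: p.2)

/-- The state reached after `n` steps when the profile `σ` is played from `s`. -/
def outcomeFrom (σ : A.Profile) (s : A.State) : ℕ → A.State :=
  fun n => (A.stepsFrom σ s n).1

/-- The outcome run of the profile `σ` from the initial state. -/
def outcome (σ : A.Profile) : ℕ → A.State :=
  A.outcomeFrom σ A.init

/-- The history (current state first) after `n` steps of `σ` from the initial state. -/
def histAt (σ : A.Profile) (n : ℕ) : List A.State :=
  (A.stepsFrom σ A.init n).2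

def IsRunFrom (s : A.State) (ρ : ℕ → A.State) : Prop :=
  ρ 0 = s ∧ ∀ n, ∃ a, A.δ (ρ n) a = ρ (n + 1)

end Arena

structure Game (ι : Type) extends Arena ι where
  obj : ι → Set (ℕ → toArena.State)

namespace Game

variable {ι : Type} [DecidableEq ι] (G : Game ι)

def Winning (i : ι) (σi : G.toArena.Strategy) : Prop :=
  ∀ σ : G.toArena.Profile, G.toArena.outcome (Function.update σ i σi) ∈ G.obj i

def Dominates (i : ι) (τ σi : G.toArena.Strategy) : Prop :=
  (∀ σ : G.toArena.Profile,
      G.toArena.outcome (Function.update σ i σi) ∈ G.obj i →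
      G.toArena.outcome (Function.update σ i τ) ∈ G.obj i) ∧
  (∃ σ : G.toArena.Profile,
      G.toArena.outcome (Function.update σ i τ) ∈ G.obj i ∧
      G.toArena.outcome (Function.update σ i σi) ∉ G.obj i)

def Admissible (i : ι) (σi : G.toArena.Strategy) : Prop :=
  ¬ ∃ τ, G.Dominates i τ σi

def Dominant (i : ι) (σi : G.toArena.Strategy) : Prop :=
  ∀ (τ : G.toArena.Strategy) (σ : G.toArena.Profile),
    G.toArena.outcome (Function.update σ i τ) ∈ G.obj i →
    G.toArena.outcome (Function.update σ i σi) ∈ G.obj i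

/-- Profile `σ` is assume-admissible winning: each `σ i` is admissible and wins `φ_i`
against every profile of admissible strategies of the other players. -/
def AAWinning (σ : G.toArena.Profile) : Prop :=
  ∀ i : ι, G.Admissible i (σ i) ∧
    ∀ σ' : G.toArena.Profile, (∀ j, j ≠ i → G.Admissible j (σ' j)) →
      G.toArena.outcome (Function.update σ' i (σ i)) ∈ G.obj i

def WinFrom (i : ι) (s : G.toArena.State) (σi : G.toArena.Strategy) : Prop :=
  ∀ σ : G.toArena.Profile,
    G.toArena.outcomeFrom (Function.update σ i σi) s ∈ G.obj i

noncomputable def val (i : ι) (s : G.toArena.State) : ℤ :=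
  if ∃ σi, G.WinFrom i s σi then 1
  else if ∀ σ : G.toArena.Profile, G.toArena.outcomeFrom σ s ∉ G.obj i then -1
  else 0

def Coop : Prop :=
  ∃ σ : G.toArena.Profile, ∀ i, G.toArena.outcome σ ∈ G.obj i

def AGand : Prop :=
  ∃ σ : G.toArena.Profile, (∀ i, G.toArena.outcome σ ∈ G.obj i) ∧
    ∀ (i : ι) (σ' : G.toArena.Profile),
      (∀ j, j ≠ i → G.toArena.outcome (Function.update σ' i (σ i)) ∈ G.obj j) →
      G.toArena.outcome (Function.update σ' i (σ i)) ∈ G.obj i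

def AGor : Prop :=
  ∃ σ : G.toArena.Profile, (∀ i, G.toArena.outcome σ ∈ G.obj i) ∧
    ∀ (i : ι) (σ' : G.toArena.Profile),
      (∃ j, j ≠ i ∧ G.toArena.outcome (Function.update σ' i (σ i)) ∈ G.obj j) →
      G.toArena.outcome (Function.update σ' i (σ i)) ∈ G.obj i

end Game

/-- States visited infinitely often by a run. -/
def infSet {S : Type} (ρ : ℕ → S) : Set S := {s | ∀ N, ∃ n, N ≤ n ∧ ρ n = s}

/-- The objectives are Muller conditions: they only depend on the set of states
visited infinitely often. -/
def Game.IsMuller {ι : Type} (G : Game ι) : Prop :=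
  ∀ (i : ι) (ρ ρ' : ℕ → G.toArena.State), infSet ρ = infSet ρ' →
    (ρ ∈ G.obj i ↔ ρ' ∈ G.obj i)

def PrefixIndep {S : Type} (φ : Set (ℕ → S)) : Prop :=
  ∀ ρ : ℕ → S, ρ ∈ φ ↔ (fun n => ρ (n + 1)) ∈ φ

namespace Game

variable {ι : Type} [DecidableEq ι] (G : Game ι)

/-- The value-preserving edges for player `i`. -/
noncomputable def Epres (i : ι) : Set (G.toArena.State × G.toArena.Act) :=
  {p | G.toArena.owner p.1 = i → G.val i (G.toArena.δ p.1 p.2) = G.val i p.1}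

/-- The run `ρ` only uses edges from `E`. -/
def RespectsEdges (E : Set (G.toArena.State × G.toArena.Act)) (ρ : ℕ → G.toArena.State) :
    Prop :=
  ∀ n, ∃ p ∈ E, ρ n = p.1 ∧ ρ (n + 1) = G.toArena.δ p.1 p.2

/-- The set of states of value `x` for player `i`. -/
noncomputable def Vset (i : ι) (x : ℤ) : Set G.toArena.State :=
  {s | G.val i s = x}

/-- The help states for player `i`: states of value 0 not owned by `i` with at least
two distinct successors of value ≥ 0. -/
noncomputable def Help (i : ι) : Set G.toArena.State :=
  {s | G.toArena.owner s ≠ i ∧ G.val i s = 0 ∧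
    ∃ s' s'' : G.toArena.State, s' ≠ s'' ∧
      (∃ a, G.toArena.δ s a = s') ∧ (∃ a, G.toArena.δ s a = s'') ∧
      0 ≤ G.val i s' ∧ 0 ≤ G.val i s''}

/-- Visiting `S` infinitely often. -/
def GFin (S : Set G.toArena.State) (ρ : ℕ → G.toArena.State) : Prop :=
  ∀ N, ∃ n, N ≤ n ∧ ρ n ∈ S

/-- The condition `Φ_i = G(E_i) ∧ (GF(V_{i,1}) → φ_i) ∧ (GF(V_{i,0}) → φ_i ∨ GF(H_i))`. -/
noncomputable def Phi (i : ι) : Set (ℕ → G.toArena.State) :=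
  {ρ | G.RespectsEdges (G.Epres i) ρ ∧
    (G.GFin (G.Vset i 1) ρ → ρ ∈ G.obj i) ∧
    (G.GFin (G.Vset i 0) ρ → (ρ ∈ G.obj i ∨ G.GFin (G.Help i) ρ))}

/-- The outcomes of all strategy profiles. -/
def OutAll : Set (ℕ → G.toArena.State) :=
  {ρ | ∃ σ : G.toArena.Profile, G.toArena.outcome σ = ρ}

end Game

namespace Stmt19

section Seq
variable {S : Type}

def hist (ρ : ℕ → S) : ℕ → List S
  | 0 => [ρ 0]
  | n + 1 => ρ (n + 1) :: hist ρ n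

def shift (ρ : ℕ → S) (N : ℕ) : ℕ → S := fun n => ρ (N + n)

def splice (ρ : ℕ → S) (N : ℕ) (γ : ℕ → S) : ℕ → S :=
  fun n => if n < N then ρ n else γ (n - N)

theorem hist_length (ρ : ℕ → S) (n : ℕ) : (hist ρ n).length = n + 1 := by
  induction n with
  | zero => rfl
  | succ n ih => simp [hist, ih]

theorem hist_eq_iff (α β : ℕ → S) (n : ℕ) :
    hist α n = hist β n ↔ ∀ k ≤ n, α k = β k := by
  induction n with
  | zero => simp [hist]
  | succ n ih =>
    simp only [hist, List.cons.injEq, ih]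
    constructor
    · rintro ⟨h1, h2⟩ k hk
      rcases Nat.lt_or_ge n k with h | h
      · have : k = n + 1 := by omega
        rw [this]; exact h1
      · exact h2 k h
    · intro h
      exact ⟨h _ le_rfl, fun k hk => h k (by omega)⟩

theorem hist_congr {α β : ℕ → S} {n : ℕ} (h : ∀ k ≤ n, α k = β k) : hist α n = hist β n :=
  (hist_eq_iff α β n).2 h

theorem hist_drop (α : ℕ → S) (N k : ℕ) : (hist α (N + k)).drop k = hist α N := by
  induction k with
  | zero => rfl
  | succ k ih => exact ih

theorem hist_take (α : ℕ → S) (N k : ℕ) :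
    (hist α (N + k)).take (k + 1) = hist (shift α N) k := by
  induction k with
  | zero => cases N <;> simp [hist, shift]
  | succ k ih =>
    have : hist α (N + (k + 1)) = α (N + (k + 1)) :: hist α (N + k) := rfl
    rw [this, List.take_succ_cons, ih]; rfl

theorem hist_append (α : ℕ → S) (N k : ℕ) :
    hist (shift α N) k ++ (hist α N).tail = hist α (N + k) := by
  induction k with
  | zero => cases N <;> simp [hist, shift]
  | succ k ih =>
    have : hist α (N + (k + 1)) = α (N + (k + 1)) :: hist α (N + k) := rfl
    rw [this, ← ih]; rfl

theorem shift_splice (ρ : ℕ → S) (N : ℕ) (γ : ℕ → S) : shift (splice ρ N γ) N = γ := by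
  funext n; simp [shift, splice]

theorem splice_agree {ρ : ℕ → S} {N : ℕ} {γ : ℕ → S} (h : γ 0 = ρ N) :
    ∀ k ≤ N, splice ρ N γ k = ρ k := by
  intro k hk
  unfold splice
  split_ifs with h1
  · rfl
  · have : k = N := by omega
    subst this; simpa using h

theorem infSet_shift (ρ : ℕ → S) (N : ℕ) : infSet (shift ρ N) = infSet ρ := by
  ext s
  simp only [infSet, shift, Set.mem_ofPred_eq]
  constructor
  · intro h M
    obtain ⟨n, h1, h2⟩ := h M
    exact ⟨N + n, by omega, h2⟩
  · intro h M
    obtain ⟨n, h1, h2⟩ := h (N + M)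
    exact ⟨n - N, by omega, by rwa [show N + (n - N) = n by omega]⟩

end Seq

section Runs
variable {ι : Type} [DecidableEq ι] {A : Arena ι}

def IsRun (A : Arena ι) (ρ : ℕ → A.State) : Prop := ∀ n, ∃ a, A.δ (ρ n) a = ρ (n + 1)

/-- `α` is consistent with the strategy `f` of player `i`. -/
def Cons (A : Arena ι) (i : ι) (f : A.Strategy) (α : ℕ → A.State) : Prop :=
  ∀ n, ∃ a, A.δ (α n) a = α (n + 1) ∧ (A.owner (α n) = i → a = f (hist α n))

def Joint (A : Arena ι) (i : ι) (α β : ℕ → A.State) : Prop :=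
  ∀ n, (∀ k ≤ n, α k = β k) → A.owner (α n) ≠ i → α (n + 1) = β (n + 1)

theorem Cons.isRun {i : ι} {f : A.Strategy} {α : ℕ → A.State} (h : Cons A i f α) : IsRun A α :=
  fun n => let ⟨a, ha, _⟩ := h n; ⟨a, ha⟩

theorem Cons.own {i : ι} {f : A.Strategy} {α : ℕ → A.State} (h : Cons A i f α) {n : ℕ}
    (ho : A.owner (α n) = i) : α (n + 1) = A.δ (α n) (f (hist α n)) := by
  obtain ⟨a, ha, hb⟩ := h n
  rw [← ha, hb ho]

/-- Two runs consistent with `f` that agree to `n`, where `i` owns the state. -/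
theorem Cons.own_agree {i : ι} {f : A.Strategy} {α β : ℕ → A.State} (h : Cons A i f α)
    (h' : Cons A i f β) {n : ℕ} (hag : ∀ k ≤ n, α k = β k)
    (ho : A.owner (α n) = i) : α (n + 1) = β (n + 1) := by
  rw [h.own ho, h'.own (by rw [← hag n le_rfl]; exact ho), hist_congr hag, hag n le_rfl]

theorem IsRun.shift {ρ : ℕ → A.State} (h : IsRun A ρ) (N : ℕ) : IsRun A (shift ρ N) :=
  fun n => h (N + n)

theorem IsRun.splice {ρ γ : ℕ → A.State} (h : IsRun A ρ) (N : ℕ) (h' : IsRun A γ)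
    (h0 : γ 0 = ρ N) : IsRun A (splice ρ N γ) := by
  intro n
  rcases Nat.lt_or_ge n N with hn | hn
  · rw [splice_agree h0 n hn.le, splice_agree h0 (n + 1) hn]; exact h n
  · obtain ⟨a, ha⟩ := h' (n - N)
    refine ⟨a, ?_⟩
    simp only [Stmt19.splice]
    rw [if_neg (by omega), if_neg (by omega), ha]
    congr 1; omega

theorem steps_eq (σ : A.Profile) (s : A.State) (n : ℕ) :
    A.stepsFrom σ s n = (A.outcomeFrom σ s n, hist (A.outcomeFrom σ s) n) := by
  induction n with
  | zero => rfl
  | succ n ih =>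
    have h2 : (A.stepsFrom σ s n).2 = hist (A.outcomeFrom σ s) n := by rw [ih]
    refine Prod.ext rfl ?_
    show A.outcomeFrom σ s (n + 1) :: (A.stepsFrom σ s n).2 = _
    rw [h2]; rfl

theorem outcome_succ (σ : A.Profile) (s : A.State) (n : ℕ) :
    A.outcomeFrom σ s (n + 1) = A.δ (A.outcomeFrom σ s n)
      (σ (A.owner (A.outcomeFrom σ s n)) (hist (A.outcomeFrom σ s) n)) := by
  have h2 : (A.stepsFrom σ s n).2 = hist (A.outcomeFrom σ s) n := by rw [steps_eq]
  rw [← h2]; rfl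

theorem outcome_unique (σ : A.Profile) (s : A.State) (ρ : ℕ → A.State) (h0 : ρ 0 = s)
    (h : ∀ n, ρ (n + 1) = A.δ (ρ n) (σ (A.owner (ρ n)) (hist ρ n))) :
    A.outcomeFrom σ s = ρ := by
  have : ∀ n, ∀ k ≤ n, A.outcomeFrom σ s k = ρ k := by
    intro n
    induction n with
    | zero => intro k hk; obtain rfl : k = 0 := by omega
              rw [h0]; rfl
    | succ n ih =>
      intro k hk
      rcases Nat.lt_or_ge n k with h1 | h1
      · obtain rfl : k = n + 1 := by omega
        rw [outcome_succ, h, hist_congr ih, ih n le_rfl]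
      · exact ih k h1
  funext n; exact this n n le_rfl

theorem outcome_cons (σ : A.Profile) (i : ι) (s : A.State) :
    Cons A i (σ i) (A.outcomeFrom σ s) := by
  intro n
  refine ⟨_, (outcome_succ σ s n).symm, ?_⟩
  intro h; rw [h]

theorem outcome_cons' (σ : A.Profile) (i : ι) (f : A.Strategy) (s : A.State) :
    Cons A i f (A.outcomeFrom (Function.update σ i f) s) := by
  have := outcome_cons (Function.update σ i f) i s
  rwa [Function.update_self] at this

theorem outcome_joint (σ : A.Profile) (i : ι) (f g : A.Strategy) (s : A.State) :
    Joint A i (A.outcomeFrom (Function.update σ i f) s)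
      (A.outcomeFrom (Function.update σ i g) s) := by
  intro n hag ho
  rw [outcome_succ, outcome_succ, hist_congr hag, ← hag n le_rfl,
    Function.update_of_ne ho, Function.update_of_ne ho]

theorem joint_profile (i : ι) (f g : A.Strategy) (s : A.State) (α β : ℕ → A.State)
    (hα : Cons A i f α) (hβ : Cons A i g β) (hα0 : α 0 = s) (hβ0 : β 0 = s)
    (hj : Joint A i α β) :
    ∃ σ : A.Profile, A.outcomeFrom (Function.update σ i f) s = α ∧
      A.outcomeFrom (Function.update σ i g) s = β := by
  choose a ha ha' using hα
  choose b hb hb' using hβ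
  refine ⟨fun _ h => if h = hist α (h.length - 1) then a (h.length - 1) else b (h.length - 1),
    ?_, ?_⟩
  · apply outcome_unique _ _ _ hα0
    intro n
    by_cases ho : A.owner (α n) = i
    · rw [ho, Function.update_self, ← ha' n ho, ha]
    · rw [Function.update_of_ne ho]
      simp [hist_length, ha]
  · apply outcome_unique _ _ _ hβ0
    intro n
    by_cases ho : A.owner (β n) = i
    · rw [ho, Function.update_self, ← hb' n ho, hb]
    · rw [Function.update_of_ne ho]
      simp only [hist_length, Nat.add_sub_cancel]
      split_ifs with h
      · have hag := (hist_eq_iff _ _ _).1 h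
        have e := hag n le_rfl
        rw [e, ha, hj n (fun k hk => (hag k hk).symm) (by rw [← e]; exact ho)]
      · rw [hb]

theorem cons_profile (i : ι) (f : A.Strategy) (s : A.State) (α : ℕ → A.State)
    (hα : Cons A i f α) (hα0 : α 0 = s) :
    ∃ σ : A.Profile, A.outcomeFrom (Function.update σ i f) s = α := by
  obtain ⟨σ, h, _⟩ := joint_profile i f f s α α hα hα hα0 hα0
    (fun n hag ho => hα.isRun n |>.elim fun _ _ => rfl)
  exact ⟨σ, h⟩

theorem run_profile (s : A.State) (α : ℕ → A.State) (h : IsRun A α) (h0 : α 0 = s) :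
    ∃ σ : A.Profile, A.outcomeFrom σ s = α := by
  choose a ha using h
  refine ⟨fun _ h => a (h.length - 1), outcome_unique _ _ _ h0 fun n => ?_⟩
  simp [hist_length, ha]

/-- Extension of a finite prefix by a function of histories. -/
theorem extend (F : A.Strategy) (α : ℕ → A.State) (N : ℕ)
    (h : ∀ n < N, ∃ a, A.δ (α n) a = α (n + 1)) :
    ∃ β : ℕ → A.State, (∀ k ≤ N, β k = α k) ∧
      ∀ n, N ≤ n → β (n + 1) = A.δ (β n) (F (hist β n)) := by
  have h' : ∀ n, ∃ a, n < N → A.δ (α n) a = α (n + 1) := by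
    intro n
    by_cases hn : n < N
    · obtain ⟨a, ha⟩ := h n hn; exact ⟨a, fun _ => ha⟩
    · exact ⟨F [], fun h => absurd h hn⟩
  choose a ha using h'
  let σ : A.Profile := fun _ h => if h.length ≤ N then a (h.length - 1) else F h
  refine ⟨A.outcomeFrom σ (α 0), ?_, ?_⟩
  · intro k
    induction k with
    | zero => intro _; rfl
    | succ k ih =>
      intro hk
      rw [outcome_succ, ih (by omega)]
      simp only [σ, hist_length]
      rw [if_pos hk, Nat.add_sub_cancel, ha k hk]
  · intro n hn
    rw [outcome_succ]
    simp only [σ, hist_length]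
    rw [if_neg (by omega)]

/-- Extension of a prefix consistent with `f`, by `f` for every player. -/
theorem extend_cons (i : ι) (f : A.Strategy) (α : ℕ → A.State) (N : ℕ)
    (h : ∀ n < N, ∃ a, A.δ (α n) a = α (n + 1) ∧ (A.owner (α n) = i → a = f (hist α n))) :
    ∃ β : ℕ → A.State, Cons A i f β ∧ (∀ k ≤ N, β k = α k) ∧
      ∀ n, N ≤ n → β (n + 1) = A.δ (β n) (f (hist β n)) := by
  obtain ⟨β, h1, h2⟩ := extend f α N (fun n hn => let ⟨a, ha, _⟩ := h n hn; ⟨a, ha⟩)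
  refine ⟨β, ?_, h1, h2⟩
  intro n
  rcases Nat.lt_or_ge n N with hn | hn
  · obtain ⟨a, ha, hb⟩ := h n hn
    refine ⟨a, ?_, ?_⟩
    · rw [h1 n hn.le, h1 (n + 1) hn, ha]
    · rw [h1 n hn.le, hist_congr (β := α) (fun k hk => h1 k (by omega))]; exact hb
  · exact ⟨_, (h2 n hn).symm, fun _ => rfl⟩

end Runs

section Val
variable {ι : Type} [DecidableEq ι] (G : Game ι) (i : ι)

theorem obj_shift (hm : G.IsMuller) (ρ : ℕ → G.State) (N : ℕ) :
    shift ρ N ∈ G.obj i ↔ ρ ∈ G.obj i := hm i _ _ (infSet_shift ρ N)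

def Wins (s : G.State) (f : G.toArena.Strategy) : Prop :=
  ∀ γ, Cons G.toArena i f γ → γ 0 = s → γ ∈ G.obj i

theorem winFrom_iff (s : G.State) (f : G.toArena.Strategy) :
    G.WinFrom i s f ↔ Wins G i s f := by
  constructor
  · intro h γ hγ h0
    obtain ⟨σ, hσ⟩ := cons_profile i f s γ hγ h0
    rw [← hσ]; exact h σ
  · intro h σ
    exact h _ (outcome_cons' σ i f s) rfl

theorem val_one (s : G.State) : G.val i s = 1 ↔ ∃ f, Wins G i s f := by
  simp only [Game.val, winFrom_iff]
  split_ifs <;> simp_all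

theorem val_cases (s : G.State) : G.val i s = 1 ∨ G.val i s = 0 ∨ G.val i s = -1 := by
  unfold Game.val
  split_ifs <;> simp

theorem val_nonneg [Nonempty G.Act] (s : G.State) :
    0 ≤ G.val i s ↔ ∃ γ, IsRun G.toArena γ ∧ γ 0 = s ∧ γ ∈ G.obj i := by
  constructor
  · intro h
    rcases val_cases G i s with h1 | h1 | h1
    · obtain ⟨f, hf⟩ := (val_one G i s).1 h1
      have hc := outcome_cons (A := G.toArena) (fun _ => f) i s
      exact ⟨_, hc.isRun, rfl, hf _ hc rfl⟩
    · by_contra hc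
      have h3 : ∀ σ : G.toArena.Profile, G.toArena.outcomeFrom σ s ∉ G.obj i :=
        fun σ hσ => hc ⟨_, (outcome_cons σ i s).isRun, rfl, hσ⟩
      unfold Game.val at h1
      rw [if_pos h3] at h1
      split_ifs at h1 <;> omega
    · omega
  · rintro ⟨γ, hγ, h0, hw⟩
    unfold Game.val
    split_ifs with h2 h3
    · simp
    · obtain ⟨σ, hσ⟩ := run_profile s γ hγ h0
      exact absurd (hσ ▸ hw) (h3 σ)
    · simp

theorem run_val_nonneg (hm : G.IsMuller) [Nonempty G.Act] {γ : ℕ → G.State} (h : IsRun G.toArena γ)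
    (hw : γ ∈ G.obj i) (n : ℕ) : 0 ≤ G.val i (γ n) :=
  (val_nonneg G i _).2 ⟨shift γ n, h.shift n, rfl, (obj_shift G i hm γ n).2 hw⟩

theorem val_back (hm : G.IsMuller) [Nonempty G.Act] {ρ : ℕ → G.State} (h : IsRun G.toArena ρ) {m n : ℕ}
    (hmn : m ≤ n) (hv : 0 ≤ G.val i (ρ n)) : 0 ≤ G.val i (ρ m) := by
  obtain ⟨γ, h1, h2, h3⟩ := (val_nonneg G i _).1 hv
  have := run_val_nonneg G i hm (γ := splice ρ n γ) (h.splice n h1 h2)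
    (by rw [← obj_shift G i hm _ n, shift_splice]; exact h3) m
  rwa [splice_agree h2 m hmn] at this

theorem val_fwd (hm : G.IsMuller) [Nonempty G.Act] {s : G.State} (hv : 0 ≤ G.val i s) :
    ∃ a, 0 ≤ G.val i (G.δ s a) := by
  obtain ⟨γ, h1, h2, h3⟩ := (val_nonneg G i _).1 hv
  obtain ⟨a, ha⟩ := h1 0
  refine ⟨a, ?_⟩
  rw [← h2, ha]
  exact run_val_nonneg G i hm h1 h3 1

theorem val_own (hm : G.IsMuller) {s : G.State} {a : G.Act} (ho : G.owner s = i)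
    (hv : G.val i (G.δ s a) = 1) : G.val i s = 1 := by
  obtain ⟨w, hw⟩ := (val_one G i _).1 hv
  refine (val_one G i _).2 ⟨fun h => if h.length = 1 then a else w (h.take (h.length - 1)), ?_⟩
  intro γ hγ h0
  have h1 : γ 1 = G.δ s a := by
    have := hγ.own (n := 0) (by rw [h0]; exact ho)
    simpa [hist, h0] using this
  rw [← obj_shift G i hm γ 1]
  refine hw _ ?_ h1
  intro n
  obtain ⟨b, hb, hc⟩ := hγ (1 + n)
  refine ⟨b, hb, fun ho => ?_⟩
  rw [hc ho]
  simp only [hist_length]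
  rw [if_neg (by omega), ← hist_take]
  congr 2; omega

theorem val_opp (hm : G.IsMuller) {s : G.State} {a : G.Act} (ho : G.owner s ≠ i)
    (hv : G.val i s = 1) : G.val i (G.δ s a) = 1 := by
  obtain ⟨w, hw⟩ := (val_one G i _).1 hv
  refine (val_one G i _).2 ⟨fun h => w (h ++ [s]), ?_⟩
  intro γ hγ h0
  have hs := shift_splice (fun _ => s) 1 γ
  rw [← hs, obj_shift G i hm]
  refine hw _ ?_ rfl
  intro n
  cases n with
  | zero => exact ⟨a, h0.symm, fun h => absurd h ho⟩
  | succ n =>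
    obtain ⟨b, hb, hc⟩ := hγ n
    refine ⟨b, hb, fun ho => ?_⟩
    rw [hc ho, Nat.add_comm n 1, ← hist_append, hs]
    rfl

/-- If the value is not one, some consistent continuation loses. -/
theorem exists_losing (hm : G.IsMuller) {f : G.toArena.Strategy} {ρ : ℕ → G.State} {N : ℕ}
    (hρ : Cons G.toArena i f ρ) (hv : G.val i (ρ N) ≠ 1) :
    ∃ α, Cons G.toArena i f α ∧ (∀ k ≤ N, α k = ρ k) ∧ α ∉ G.obj i := by
  have h1 : ¬ Wins G i (ρ N) (fun l => f (l ++ (hist ρ N).tail)) :=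
    fun h => hv ((val_one G i _).2 ⟨_, h⟩)
  unfold Wins at h1
  push Not at h1
  obtain ⟨γ, hγ, h0, hl⟩ := h1
  have hag := splice_agree h0
  have hs := shift_splice ρ N γ
  refine ⟨splice ρ N γ, ?_, hag, ?_⟩
  · intro n
    rcases Nat.lt_or_ge n N with hn | hn
    · rw [hag n hn.le, hag (n + 1) hn, hist_congr (β := ρ) (fun k hk => hag k (by omega))]
      exact hρ n
    · obtain ⟨k, rfl⟩ := Nat.exists_eq_add_of_le hn
      have e : ∀ k, splice ρ N γ (N + k) = γ k := fun k => congrFun hs k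
      rw [← hist_append, hs, Nat.add_assoc, e, e, hist_congr hag]
      exact hγ k
  · rwa [← obj_shift G i hm _ N, hs]

end Val

section Adm
variable {ι : Type} [DecidableEq ι] (G : Game ι) (i : ι)

/-- Switch to `g` once the history of `ρ` up to `N` has been seen. -/
noncomputable def sw (f : G.toArena.Strategy) (ρ : ℕ → G.State) (N : ℕ) (g : G.toArena.Strategy) :
    G.toArena.Strategy := fun h =>
  if N + 1 ≤ h.length ∧ h.drop (h.length - (N + 1)) = hist ρ N then g (h.take (h.length - N))
  else f h

variable {G} {f g : G.toArena.Strategy} {ρ α β : ℕ → G.State} {N : ℕ}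

theorem sw_neg (h : ∀ n, N ≤ n → n = n → ¬ ∀ k ≤ N, α k = ρ k) (n : ℕ) :
    sw G f ρ N g (hist α n) = f (hist α n) := by
  unfold sw
  rw [if_neg]
  rintro ⟨h1, h2⟩
  rw [hist_length] at h1 h2
  have hn : N ≤ n := by omega
  obtain ⟨k, rfl⟩ := Nat.exists_eq_add_of_le hn
  rw [show N + k + 1 - (N + 1) = k by omega, hist_drop] at h2
  exact h _ hn rfl ((hist_eq_iff _ _ _).1 h2)

theorem sw_lt {n : ℕ} (h : n < N) : sw G f ρ N g (hist α n) = f (hist α n) := by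
  unfold sw
  rw [if_neg]
  rintro ⟨h1, h2⟩
  rw [hist_length] at h1
  omega

theorem sw_pos (h : ∀ k ≤ N, α k = ρ k) (n : ℕ) :
    sw G f ρ N g (hist α (N + n)) = g (hist (shift α N) n) := by
  unfold sw
  rw [if_pos, hist_length, ← hist_take]
  · congr 2; omega
  · rw [hist_length, show N + n + 1 - (N + 1) = n by omega, hist_drop]
    exact ⟨by omega, hist_congr h⟩

theorem sw_shift_cons (hβ : Cons G.toArena i (sw G f ρ N g) β) (h : ∀ k ≤ N, β k = ρ k) :
    Cons G.toArena i g (shift β N) := by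
  intro n
  obtain ⟨a, ha, hb⟩ := hβ (N + n)
  refine ⟨a, ha, fun ho => ?_⟩
  rw [hb ho, sw_pos h]

theorem sw_agree (hα : Cons G.toArena i f α) (hβ : Cons G.toArena i (sw G f ρ N g) β)
    (hj : Joint G.toArena i α β) (h0 : α 0 = β 0) : ∀ n ≤ N, ∀ k ≤ n, α k = β k := by
  intro n
  induction n with
  | zero => intro _ k hk; obtain rfl : k = 0 := by omega
            exact h0
  | succ n ih =>
    intro hn k hk
    have ih := ih (by omega)
    rcases Nat.lt_or_ge n k with h1 | h1
    · obtain rfl : k = n + 1 := by omega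
      by_cases ho : G.owner (α n) = i
      · rw [hα.own ho, hβ.own (by rw [← ih n le_rfl]; exact ho), sw_lt (by omega),
          hist_congr ih, ih n le_rfl]
      · exact hj n ih ho
    · exact ih k h1

theorem sw_eq (hα : Cons G.toArena i f α) (hβ : Cons G.toArena i (sw G f ρ N g) β)
    (hj : Joint G.toArena i α β) (h0 : α 0 = β 0) (hna : ¬ ∀ k ≤ N, α k = ρ k) : α = β := by
  have hN := sw_agree i hα hβ hj h0 N le_rfl
  have hnb : ∀ n, N ≤ n → n = n → ¬ ∀ k ≤ N, β k = ρ k := by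
    intro _ _ _ h
    exact hna fun k hk => (hN k hk).trans (h k hk)
  have : ∀ n, ∀ k ≤ n, α k = β k := by
    intro n
    induction n with
    | zero => intro k hk; obtain rfl : k = 0 := by omega
              exact h0
    | succ n ih =>
      intro k hk
      rcases Nat.lt_or_ge n k with h1 | h1
      · obtain rfl : k = n + 1 := by omega
        by_cases ho : G.owner (α n) = i
        · rw [hα.own ho, hβ.own (by rw [← ih n le_rfl]; exact ho), sw_neg hnb,
            hist_congr ih, ih n le_rfl]
        · exact hj n ih ho
      · exact ih k h1
  funext n; exact this n n le_rfl

/-- An admissible strategy wins from every consistent history of value one. -/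
theorem adm_one (hm : G.IsMuller) (hf : G.Admissible i f) (hα : Cons G.toArena i f α)
    (h0 : α 0 = G.init) (hv : G.val i (α N) = 1) : α ∈ G.obj i := by
  by_contra hl
  obtain ⟨w, hw⟩ := (val_one G i _).1 hv
  have key : ∀ γ, Cons G.toArena i (sw G f α N w) γ → (∀ k ≤ N, γ k = α k) → γ ∈ G.obj i := by
    intro γ hγ hag
    rw [← obj_shift G i hm γ N]
    exact hw _ (sw_shift_cons i hγ hag) (hag N le_rfl)
  apply hf
  refine ⟨sw G f α N w, ?_, ?_⟩
  · intro σ h1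
    have c1 := outcome_cons' σ i f G.init
    have c2 := outcome_cons' σ i (sw G f α N w) G.init
    have hj := outcome_joint σ i f (sw G f α N w) G.init
    by_cases hag : ∀ k ≤ N, G.outcome (Function.update σ i f) k = α k
    · exact key _ c2 fun k hk => (sw_agree i c1 c2 hj rfl N le_rfl k hk).symm.trans (hag k hk)
    · have := sw_eq i c1 c2 hj rfl hag
      unfold Arena.outcome at *
      rwa [← this]
  · obtain ⟨σ, hσ⟩ := cons_profile i f _ α hα h0
    refine ⟨σ, ?_, by unfold Arena.outcome; rwa [hσ]⟩
    have c2 := outcome_cons' σ i (sw G f α N w) G.init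
    have hj := outcome_joint σ i f (sw G f α N w) G.init
    rw [hσ] at hj
    exact key _ c2 fun k hk => (sw_agree i hα c2 hj h0 N le_rfl k hk).symm

/-- An admissible strategy can win from every consistent history of value at least zero. -/
theorem adm_zero (hm : G.IsMuller) [Nonempty G.Act] (hf : G.Admissible i f)
    (hρ : Cons G.toArena i f ρ)
    (h0 : ρ 0 = G.init) (hv : 0 ≤ G.val i (ρ N)) :
    ∃ α, Cons G.toArena i f α ∧ (∀ k ≤ N, α k = ρ k) ∧ α ∈ G.obj i := by
  by_contra hcon
  push Not at hcon
  obtain ⟨γ, hγ, hγ0, hw⟩ := (val_nonneg G i _).1 hv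
  have hγ' := hγ
  choose a ha using hγ'
  set g : G.toArena.Strategy := fun h => a (h.length - 1) with hg
  have hag0 := splice_agree hγ0
  have hs := shift_splice ρ N γ
  have hβ : Cons G.toArena i (sw G f ρ N g) (splice ρ N γ) := by
    intro n
    rcases Nat.lt_or_ge n N with hn | hn
    · rw [sw_lt hn, hag0 n hn.le, hag0 (n + 1) hn,
        hist_congr (β := ρ) (fun k hk => hag0 k (by omega))]
      exact hρ n
    · obtain ⟨k, rfl⟩ := Nat.exists_eq_add_of_le hn
      have e : ∀ k, splice ρ N γ (N + k) = γ k := fun k => congrFun hs k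
      rw [sw_pos hag0, hs, Nat.add_assoc, e, e]
      exact ⟨a k, ha k, fun _ => by simp [hg, hist_length]⟩
  have hβ0 : splice ρ N γ 0 = G.init := (hag0 0 (by omega)).trans h0
  apply hf
  refine ⟨sw G f ρ N g, ?_, ?_⟩
  · intro σ h1
    have c1 := outcome_cons' σ i f G.init
    have c2 := outcome_cons' σ i (sw G f ρ N g) G.init
    have hj := outcome_joint σ i f (sw G f ρ N g) G.init
    by_cases hag : ∀ k ≤ N, G.outcome (Function.update σ i f) k = ρ k
    · exact absurd h1 (hcon _ c1 hag)
    · have := sw_eq i c1 c2 hj rfl hag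
      unfold Arena.outcome at *
      rwa [← this]
  · obtain ⟨σ, hσ⟩ := cons_profile i _ _ _ hβ hβ0
    refine ⟨σ, ?_, ?_⟩
    · unfold Arena.outcome
      rw [hσ, ← obj_shift G i hm _ N, hs]; exact hw
    · have c1 := outcome_cons' σ i f G.init
      have hj := outcome_joint σ i f (sw G f ρ N g) G.init
      rw [hσ] at hj
      exact hcon _ c1 fun k hk => (sw_agree i c1 hβ hj hβ0.symm N le_rfl k hk).trans (hag0 k hk)

theorem adm_phi (hm : G.IsMuller) [Nonempty G.Act] (hf : G.Admissible i f)
    (hρ : Cons G.toArena i f ρ) (h0 : ρ 0 = G.init) : ρ ∈ G.Phi i := by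
  refine ⟨?_, ?_, ?_⟩
  · intro n
    obtain ⟨a, ha, hb⟩ := hρ n
    refine ⟨(ρ n, a), ?_, rfl, ha.symm⟩
    intro ho
    dsimp only at ho ⊢
    have hown : G.val i (ρ (n + 1)) = 1 → G.val i (ρ n) = 1 := by
      rw [← ha]; exact val_own G i hm ho
    rw [ha]
    rcases val_cases G i (ρ n) with hv | hv | hv
    · rw [hv]
      by_contra hne
      obtain ⟨α, h1, h2, h3⟩ := exists_losing G i hm hρ hne
      exact h3 (adm_one i hm hf h1 ((h2 0 (by omega)).trans h0)
        (N := n) (by rw [h2 n (by omega)]; exact hv))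
    · obtain ⟨α, h1, h2, h3⟩ := adm_zero i hm hf hρ h0 (N := n) (by omega)
      have h4 := run_val_nonneg G i hm h1.isRun h3 (n + 1)
      rw [h1.own_agree hρ h2 (by rw [h2 n le_rfl]; exact ho)] at h4
      rcases val_cases G i (ρ (n + 1)) with hv' | hv' | hv'
      · have := hown hv'; omega
      · omega
      · omega
    · have h5 := val_back G i hm hρ.isRun (show n ≤ n + 1 by omega)
      rcases val_cases G i (ρ (n + 1)) with hv' | hv' | hv' <;> omega
  · intro h
    obtain ⟨n, _, hn⟩ := h 0
    exact adm_one i hm hf hρ h0 hn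
  · intro h
    by_contra hcon
    push Not at hcon
    obtain ⟨hl, hH⟩ := hcon
    unfold Game.GFin at hH
    push Not at hH
    obtain ⟨N, hN⟩ := hH
    have hz : ∀ n, G.val i (ρ n) = 0 := by
      intro n
      obtain ⟨m, h1, h2⟩ := h n
      have h3 : G.val i (ρ m) = 0 := h2
      have := val_back G i hm hρ.isRun h1 (by omega)
      rcases val_cases G i (ρ n) with hv | hv | hv
      · exact absurd (adm_one i hm hf hρ h0 hv) hl
      · exact hv
      · omega
    obtain ⟨α, h1, h2, h3⟩ := adm_zero i hm hf hρ h0 (N := N) (by rw [hz])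
    have : ∀ n, ∀ k ≤ N + n, α k = ρ k := by
      intro n
      induction n with
      | zero => exact h2
      | succ n ih =>
        intro k hk
        rcases Nat.lt_or_ge (N + n) k with h5 | h5
        · obtain rfl : k = N + n + 1 := by omega
          by_cases ho : G.owner (α (N + n)) = i
          · exact h1.own_agree hρ ih ho
          · by_contra hne
            have e := ih (N + n) le_rfl
            apply hN (N + n) (by omega)
            refine ⟨by rw [← e]; exact ho, hz _, _, _, hne, ?_, hρ.isRun _, ?_, ?_⟩
            · rw [← e]; exact h1.isRun _
            · exact run_val_nonneg G i hm h1.isRun h3 _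
            · rw [hz]
        · exact ih k h5
    have e : α = ρ := by funext n; exact this n n (by omega)
    exact hl (e ▸ h3)

end Adm

section Construct
variable {ι : Type} [DecidableEq ι] (G : Game ι) (i : ι)

abbrev Mode := (ℕ → G.State) ⊕ (G.toArena.Strategy × List G.State)

variable (ρ : ℕ → G.State) (r : G.State → ℕ → G.State) (w : G.State → G.toArena.Strategy)

noncomputable def fresh (t : G.State) : Mode G :=
  if G.val i t = 1 then Sum.inr (w t, [t]) else Sum.inl (r t)

noncomputable def nextMode (t : G.State) : Mode G → Mode G
  | Sum.inl p => if t = p 1 ∧ G.val i t ≠ 1 then Sum.inl (shift p 1) else fresh G i r w t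
  | Sum.inr q => Sum.inr (q.1, t :: q.2)

noncomputable def mode : List G.State → Mode G
  | [] => Sum.inl ρ
  | t :: h => if t :: h = hist ρ h.length then Sum.inl (shift ρ h.length)
      else nextMode G i r w t (mode h)

noncomputable def act [Nonempty G.Act] : Mode G → G.Act
  | Sum.inl p => Classical.epsilon fun a => G.δ (p 0) a = p 1
  | Sum.inr q => q.1 q.2

noncomputable def strat [Nonempty G.Act] : G.toArena.Strategy :=
  fun h => act G (mode G i ρ r w h)

variable {G} {ρ r w} [Nonempty G.Act]

theorem mode_on {α : ℕ → G.State} {n : ℕ} (h : ∀ k ≤ n, α k = ρ k) :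
    mode G i ρ r w (hist α n) = Sum.inl (shift ρ n) := by
  rw [hist_congr h]
  cases n with
  | zero => simp [hist, mode]
  | succ n => simp [hist, mode, hist_length]

theorem mode_off {α : ℕ → G.State} {n : ℕ} (h : ¬ ∀ k ≤ n + 1, α k = ρ k) :
    mode G i ρ r w (hist α (n + 1)) =
      nextMode G i r w (α (n + 1)) (mode G i ρ r w (hist α n)) := by
  have : ¬ (α (n + 1) :: hist α n = hist ρ (n + 1)) := by
    intro h'; exact h ((hist_eq_iff α ρ (n + 1)).1 h')
  change mode G i ρ r w (α (n + 1) :: hist α n) = _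
  simp only [mode, hist_length]
  rw [if_neg this]

theorem act_inl {p : ℕ → G.State} (hp : IsRun G.toArena p) :
    G.δ (p 0) (act G (Sum.inl p)) = p 1 :=
  Classical.epsilon_spec (p := fun a => G.δ (p 0) a = p 1) (hp 0)

theorem strat_on (hρ : IsRun G.toArena ρ) : Cons G.toArena i (strat G i ρ r w) ρ := by
  intro n
  have h : strat G i ρ r w (hist ρ n) = act G (Sum.inl (shift ρ n)) := by
    unfold strat; rw [mode_on i (fun _ _ => rfl)]
  by_cases ho : G.owner (ρ n) = i
  · exact ⟨strat G i ρ r w (hist ρ n), by rw [h]; exact act_inl (hρ.shift n), fun _ => rfl⟩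
  · obtain ⟨a, ha⟩ := hρ n
    exact ⟨a, ha, fun h => absurd h ho⟩

/-- The invariant on following modes. -/
theorem inv_inl (hm : G.IsMuller) (hρ : IsRun G.toArena ρ) (hr : ∀ t, IsRun G.toArena (r t))
    (hr0 : ∀ t, r t 0 = t) (hrw : ∀ t, 0 ≤ G.val i t → r t ∈ G.obj i)
    {α : ℕ → G.State} (hα : IsRun G.toArena α) (h0 : α 0 = ρ 0) (n : ℕ) :
    ∀ p, mode G i ρ r w (hist α n) = Sum.inl p → p 0 = α n ∧ IsRun G.toArena p ∧
      ((¬ ∀ k ≤ n, α k = ρ k) → G.val i (α n) ≠ 1 ∧ (0 ≤ G.val i (α n) → p ∈ G.obj i)) := by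
  induction n with
  | zero =>
    intro p hp
    have hag : ∀ k ≤ 0, α k = ρ k := by
      intro k hk; obtain rfl : k = 0 := by omega
      exact h0
    rw [mode_on i hag] at hp
    obtain rfl := Sum.inl.inj hp
    exact ⟨h0.symm, hρ.shift 0, fun h => absurd hag h⟩
  | succ n ih =>
    intro p hp
    by_cases hag : ∀ k ≤ n + 1, α k = ρ k
    · rw [mode_on i hag] at hp
      obtain rfl := Sum.inl.inj hp
      exact ⟨(hag _ le_rfl).symm, hρ.shift _, fun h => absurd hag h⟩
    · have hfr : fresh G i r w (α (n + 1)) = Sum.inl p → p 0 = α (n + 1) ∧ IsRun G.toArena p ∧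
          ((¬ ∀ k ≤ n + 1, α k = ρ k) → G.val i (α (n + 1)) ≠ 1 ∧
            (0 ≤ G.val i (α (n + 1)) → p ∈ G.obj i)) := by
        intro h
        unfold fresh at h
        split_ifs at h with hv
        obtain rfl := Sum.inl.inj h
        exact ⟨hr0 _, hr _, fun _ => ⟨hv, hrw _⟩⟩
      rw [mode_off i hag] at hp
      rcases hq : mode G i ρ r w (hist α n) with q | q
      · rw [hq] at hp
        obtain ⟨i1, i2, i3⟩ := ih q hq
        simp only [nextMode] at hp
        split_ifs at hp with hc
        · obtain rfl := Sum.inl.inj hp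
          refine ⟨hc.1.symm, i2.shift 1, fun _ => ⟨hc.2, fun hv => ?_⟩⟩
          have hdev : ¬ ∀ k ≤ n, α k = ρ k := by
            intro h
            rw [mode_on i h] at hq
            obtain rfl := Sum.inl.inj hq
            apply hag
            intro k hk
            rcases Nat.lt_or_ge n k with h1 | h1
            · obtain rfl : k = n + 1 := by omega
              exact hc.1
            · exact h k h1
          rw [obj_shift G i hm]
          exact (i3 hdev).2 (val_back G i hm hα (Nat.le_succ n) hv)
        · exact hfr hp
      · rw [hq] at hp
        simp [nextMode] at hp

/-- The invariant on locked modes. -/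
theorem inv_inr (hww : ∀ t, G.val i t = 1 → Wins G i t (w t))
    {α : ℕ → G.State} (h0 : α 0 = ρ 0) (n : ℕ) :
    ∀ q, mode G i ρ r w (hist α n) = Sum.inr q → ∃ k ≤ n, Wins G i (α k) q.1 ∧
      ∀ m, k + m ≤ n → mode G i ρ r w (hist α (k + m)) = Sum.inr (q.1, hist (shift α k) m) := by
  induction n with
  | zero =>
    intro q hq
    have hag : ∀ k ≤ 0, α k = ρ k := by
      intro k hk; obtain rfl : k = 0 := by omega
      exact h0
    rw [mode_on i hag] at hq
    cases hq
  | succ n ih =>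
    intro q hp
    have hp' := hp
    by_cases hag : ∀ k ≤ n + 1, α k = ρ k
    · rw [mode_on i hag] at hp
      cases hp
    · rw [mode_off i hag] at hp
      rcases hq : mode G i ρ r w (hist α n) with p | q'
      · rw [hq] at hp
        simp only [nextMode] at hp
        split_ifs at hp with hc
        unfold fresh at hp
        split_ifs at hp with hv
        obtain rfl := Sum.inr.inj hp
        refine ⟨n + 1, le_rfl, hww _ hv, fun m hmm => ?_⟩
        obtain rfl : m = 0 := by omega
        exact hp'
      · rw [hq] at hp
        simp only [nextMode] at hp
        obtain rfl := Sum.inr.inj hp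
        obtain ⟨k, hk, h1, h2⟩ := ih q' hq
        refine ⟨k, by omega, h1, fun m hmm => ?_⟩
        rcases Nat.lt_or_ge n (k + m) with h3 | h3
        · obtain ⟨m, rfl⟩ : ∃ m', m = m' + 1 := ⟨m - 1, by omega⟩
          have e : k + (m + 1) = n + 1 := by omega
          rw [e, hp']
          have e2 : k + m = n := by omega
          have h4 := h2 m (by omega)
          rw [e2, hq] at h4
          have h5 := Sum.inr.inj h4
          have h6 : q'.2 = hist (shift α k) m := by rw [h5]
          rw [h6]
          simp only [hist, shift]
          rw [e]
        · exact h2 m h3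

/-- once locked, the run is winning. -/
theorem locked_wins (hm : G.IsMuller) (hww : ∀ t, G.val i t = 1 → Wins G i t (w t))
    {α : ℕ → G.State} (hα : Cons G.toArena i (strat G i ρ r w) α) (h0 : α 0 = ρ 0) {n : ℕ}
    {q} (hq : mode G i ρ r w (hist α n) = Sum.inr q) : α ∈ G.obj i := by
  obtain ⟨k, hk, h1, h2⟩ := inv_inr i hww h0 n q hq
  have h3 : ∀ m, mode G i ρ r w (hist α (k + m)) = Sum.inr (q.1, hist (shift α k) m) := by
    intro m
    induction m with
    | zero => exact h2 0 (by omega)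
    | succ m ih =>
      rcases Nat.lt_or_ge n (k + (m + 1)) with h3 | h3
      · have hag : ¬ ∀ j ≤ k + m + 1, α j = ρ j := by
          intro h
          have := mode_on (r := r) (w := w) i (n := k + m) fun j hj => h j (by omega)
          rw [ih] at this
          cases this
        have := mode_off (r := r) (w := w) i hag
        rw [ih] at this
        exact this
      · exact h2 _ h3
  rw [← obj_shift G i hm α k]
  refine h1 _ ?_ rfl
  intro m
  obtain ⟨a, ha, hb⟩ := hα (k + m)
  refine ⟨a, ha, fun ho => ?_⟩
  rw [hb ho]
  unfold strat
  rw [h3]; rfl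

theorem exists_strat (hm : G.IsMuller) (hρ : IsRun G.toArena ρ) :
    ∃ f : G.toArena.Strategy, Cons G.toArena i f ρ ∧
      (∀ α N, Cons G.toArena i f α → α 0 = ρ 0 → (¬ ∀ k ≤ N, α k = ρ k) →
        G.val i (α N) = 1 → α ∈ G.obj i) ∧
      (∀ α N, Cons G.toArena i f α → α 0 = ρ 0 → (¬ ∀ k ≤ N, α k = ρ k) →
        0 ≤ G.val i (α N) →
        ∃ β, Cons G.toArena i f β ∧ (∀ k ≤ N, β k = α k) ∧ β ∈ G.obj i) := by
  have hr : ∀ t, ∃ p, IsRun G.toArena p ∧ p 0 = t ∧ (0 ≤ G.val i t → p ∈ G.obj i) := by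
    intro t
    by_cases hv : 0 ≤ G.val i t
    · obtain ⟨p, h1, h2, h3⟩ := (val_nonneg G i t).1 hv
      exact ⟨p, h1, h2, fun _ => h3⟩
    · exact ⟨_, (outcome_cons (A := G.toArena) (fun _ _ => Classical.arbitrary _) i t).isRun, rfl,
        fun h => absurd h hv⟩
  choose r hr hr0 hrw using hr
  have hw : ∀ t, ∃ f, G.val i t = 1 → Wins G i t f := by
    intro t
    by_cases hv : G.val i t = 1
    · obtain ⟨f, hf⟩ := (val_one G i t).1 hv
      exact ⟨f, fun _ => hf⟩
    · exact ⟨fun _ => Classical.arbitrary _, fun h => absurd h hv⟩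
  choose w hww using hw
  refine ⟨strat G i ρ r w, strat_on i hρ, ?_, ?_⟩
  · intro α N hα h0 hdev hv
    rcases hq : mode G i ρ r w (hist α N) with p | q
    · exact absurd hv ((inv_inl i hm hρ hr hr0 hrw hα.isRun h0 N p hq).2.2 hdev).1
    · exact locked_wins i hm hww hα h0 hq
  · intro α N hα h0 hdev hv
    obtain ⟨β, hβ, hag, hstep⟩ := extend_cons i (strat G i ρ r w) α N (fun n _ => hα n)
    refine ⟨β, hβ, hag, ?_⟩
    have hβ0 : β 0 = ρ 0 := (hag 0 (by omega)).trans h0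
    by_contra hl
    have hinl : ∀ n, ∃ p, mode G i ρ r w (hist β n) = Sum.inl p := by
      intro n
      rcases hq : mode G i ρ r w (hist β n) with p | q
      · exact ⟨p, rfl⟩
      · exact absurd (locked_wins i hm hww hβ hβ0 hq) hl
    have hdevβ : ∀ n, ¬ ∀ k ≤ N + n, β k = ρ k := by
      intro n h
      exact hdev fun k hk => (hag k hk).symm.trans (h k (by omega))
    obtain ⟨p, hp⟩ := hinl N
    obtain ⟨p0, prun, pw⟩ := inv_inl i hm hρ hr hr0 hrw hβ.isRun hβ0 N p hp
    have hpw := (pw (hdevβ 0)).2 (by rw [hag N le_rfl]; exact hv)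
    have hmode : ∀ n, mode G i ρ r w (hist β (N + n)) = Sum.inl (shift p n) := by
      intro n
      induction n with
      | zero =>
        have : shift p 0 = p := by funext k; simp [shift]
        rw [this]; exact hp
      | succ n ih =>
        obtain ⟨e0, _, _⟩ := inv_inl i hm hρ hr hr0 hrw hβ.isRun hβ0 (N + n) _ ih
        have h1 := mode_off (r := r) (w := w) i (hdevβ (n + 1))
        rw [show N + (n + 1) = N + n + 1 from rfl]
        have h2 : β (N + n + 1) = shift p n 1 := by
          rw [hstep (N + n) (by omega)]
          unfold strat
          rw [ih, ← e0]
          exact act_inl (prun.shift n)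
        obtain ⟨p', hp'⟩ := hinl (N + n + 1)
        have h3 := (inv_inl i hm hρ hr hr0 hrw hβ.isRun hβ0 _ p' hp').2.2 (hdevβ (n + 1))
        have h4 : mode G i ρ r w (hist β (N + n + 1)) = _ := h1
        rw [h4]
        change nextMode G i r w (β (N + n + 1)) (mode G i ρ r w (hist β (N + n))) = _
        rw [ih]
        simp only [nextMode]
        rw [if_pos ⟨h2, h3.1⟩]
        congr 1
        funext k
        simp only [shift]
        congr 1; omega
    apply hl
    rw [← obj_shift G i hm β N]
    have : shift β N = p := by
      funext n
      exact (inv_inl i hm hρ hr hr0 hrw hβ.isRun hβ0 (N + n) _ (hmode n)).1.symm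
    rw [this]; exact hpw

end Construct

section Back
variable {ι : Type} [DecidableEq ι] {G : Game ι} (i : ι) {ρ : ℕ → G.State}

/-- First deviation of two sequences that are different but start equal. -/
theorem first_dev {S : Type} {α β : ℕ → S} (h0 : α 0 = β 0) (hne : α ≠ β) :
    ∃ N, (∀ k ≤ N, α k = β k) ∧ α (N + 1) ≠ β (N + 1) := by
  have hex : ∃ n, α n ≠ β n := by
    by_contra h; push Not at h; exact hne (funext h)
  have h1 := Nat.find_spec hex
  have h2 := fun k (hk : k < Nat.find hex) => Nat.find_min hex hk
  have h3 : Nat.find hex ≠ 0 := by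
    intro h; rw [h] at h1; exact h1 h0
  refine ⟨Nat.find hex - 1, fun k hk => ?_, ?_⟩
  · by_contra h; exact h2 k (by omega) h
  · rwa [Nat.sub_add_cancel (by omega)]

theorem phi_pres (hP : G.RespectsEdges (G.Epres i) ρ) (n : ℕ) (ho : G.owner (ρ n) = i) :
    G.val i (ρ (n + 1)) = G.val i (ρ n) := by
  obtain ⟨p, hp, h1, h2⟩ := hP n
  rw [h2, h1]
  exact hp (h1 ▸ ho)

theorem phi_adm (hm : G.IsMuller) [Nonempty G.Act] (hρ : IsRun G.toArena ρ)
    (h0 : ρ 0 = G.init) (hP : ρ ∈ G.Phi i) :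
    ∃ f : G.toArena.Strategy, Cons G.toArena i f ρ ∧ G.Admissible i f := by
  obtain ⟨f, hf, P1, P2⟩ := exists_strat i hm hρ
  refine ⟨f, hf, ?_⟩
  obtain ⟨hE, hV1, hV0⟩ := hP
  have hpres := phi_pres i hE
  have hclosed : ∀ N, G.val i (ρ N) = 1 → ∀ k, G.val i (ρ (N + k)) = 1 := by
    intro N hN k
    induction k with
    | zero => exact hN
    | succ k ih =>
      by_cases ho : G.owner (ρ (N + k)) = i
      · exact (hpres _ ho).trans ih
      · obtain ⟨a, ha⟩ := hρ (N + k)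
        rw [show N + (k + 1) = N + k + 1 from rfl, ← ha]
        exact val_opp G i hm ho ih
  -- along `ρ`, histories of value zero can be won
  have hwinρ : ∀ N, G.val i (ρ N) = 0 →
      ∃ α, Cons G.toArena i f α ∧ (∀ k ≤ N, α k = ρ k) ∧ α ∈ G.obj i := by
    intro N hN
    by_cases hw : ρ ∈ G.obj i
    · exact ⟨ρ, hf, fun _ _ => rfl, hw⟩
    have hM : ∃ M, N ≤ M ∧ G.owner (ρ M) ≠ i ∧ ∃ a, G.δ (ρ M) a ≠ ρ (M + 1) ∧
        0 ≤ G.val i (G.δ (ρ M) a) := by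
      by_cases hg0 : G.GFin (G.Vset i 0) ρ
      · rcases hV0 hg0 with h | h
        · exact absurd h hw
        · obtain ⟨M, hNM, h1, h2, s', s'', hne, ⟨a, ha⟩, ⟨b, hb⟩, h3, h4⟩ := h N
          refine ⟨M, hNM, h1, ?_⟩
          by_cases e : s' = ρ (M + 1)
          · exact ⟨b, by rw [hb, ← e]; exact hne.symm, by rw [hb]; exact h4⟩
          · exact ⟨a, by rw [ha]; exact e, by rw [ha]; exact h3⟩
      · have hg1 : ¬ G.GFin (G.Vset i 1) ρ := fun h => hw (hV1 h)
        unfold Game.GFin at hg0 hg1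
        push Not at hg0 hg1
        obtain ⟨N0, hN0⟩ := hg0
        obtain ⟨N1, hN1⟩ := hg1
        have hex : ∃ k, ¬ 0 ≤ G.val i (ρ (N + k)) := by
          refine ⟨N0 + N1, ?_⟩
          have a0 : G.val i (ρ (N + (N0 + N1))) ≠ 0 := hN0 _ (by omega)
          have a1 : G.val i (ρ (N + (N0 + N1))) ≠ 1 := hN1 _ (by omega)
          rcases val_cases G i (ρ (N + (N0 + N1))) with h | h | h <;> omega
        have h1 := Nat.find_spec hex
        have h2 := fun k (hk : k < Nat.find hex) => Nat.find_min hex hk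
        rcases hk : Nat.find hex with _ | k
        · rw [hk] at h1
          exact absurd (le_of_eq hN.symm) h1
        · rw [hk] at h1
          have h3 : 0 ≤ G.val i (ρ (N + k)) := by
            have := h2 k (by omega)
            omega
          refine ⟨N + k, by omega, ?_, ?_⟩
          · intro ho
            have h4 := hpres _ ho
            apply h1
            rw [← Nat.add_assoc, h4]; exact h3
          · obtain ⟨a, ha⟩ := val_fwd G i hm h3
            refine ⟨a, ?_, ha⟩
            intro e
            apply h1
            rw [← Nat.add_assoc, ← e]; exact ha
    obtain ⟨M, hNM, ho, a, hne, hv⟩ := hM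
    obtain ⟨β, hβ, hag, _⟩ := extend_cons i f (fun n => if n ≤ M then ρ n else G.δ (ρ M) a)
      (M + 1) (by
        intro n hn
        have e : hist (fun n => if n ≤ M then ρ n else G.δ (ρ M) a) n = hist ρ n :=
          hist_congr fun k hk => if_pos (by omega)
        rw [e]
        rcases Nat.lt_or_ge n M with h | h
        · simp only [if_pos h.le, if_pos (show n + 1 ≤ M from h)]
          exact hf n
        · obtain rfl : n = M := by omega
          simp only [le_refl, if_true, show ¬ n + 1 ≤ n by omega, if_false]
          exact ⟨a, rfl, fun h => absurd h ho⟩)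
    have hβρ : ∀ k ≤ M, β k = ρ k := by
      intro k hk
      rw [hag k (by omega)]; exact if_pos hk
    have hβM : β (M + 1) = G.δ (ρ M) a := by
      rw [hag _ le_rfl]; exact if_neg (by omega)
    obtain ⟨γ, c1, c2, c3⟩ := P2 β (M + 1) hβ (hβρ 0 (by omega))
      (fun h => hne (hβM.symm.trans (h _ le_rfl))) (by rw [hβM]; exact hv)
    exact ⟨γ, c1, fun k hk => (c2 k (by omega)).trans (hβρ k (by omega)), c3⟩
  rintro ⟨τ, hdom, σ, hσw, hσl⟩
  have hα := outcome_cons' σ i f G.init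
  have hβ := outcome_cons' σ i τ G.init
  have hj := outcome_joint σ i f τ G.init
  have hα0 : G.outcomeFrom (Function.update σ i f) G.init 0 = G.init := rfl
  have hβ0 : G.outcomeFrom (Function.update σ i τ) G.init 0 = G.init := rfl
  unfold Arena.outcome at hσw hσl
  generalize G.outcomeFrom (Function.update σ i f) G.init = α at *
  generalize G.outcomeFrom (Function.update σ i τ) G.init = β at *
  obtain ⟨N, hag, hne⟩ := first_dev (hα0.trans hβ0.symm) (fun h => hσl (h ▸ hσw))
  have ho : G.owner (α N) = i := by
    by_contra ho; exact hne (hj N hag ho)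
  have hαρ0 : α 0 = ρ 0 := hα0.trans h0.symm
  have hv0 : 0 ≤ G.val i (α N) := by
    rw [hag N le_rfl]; exact run_val_nonneg G i hm hβ.isRun hσw N
  have hv1 : G.val i (α N) ≠ 1 := by
    intro hv
    by_cases hd : ∀ k ≤ N, α k = ρ k
    · rw [hd N le_rfl] at hv
      have hc := hclosed N hv
      by_cases e : α = ρ
      · apply hσl
        rw [e]
        exact hV1 fun M => ⟨N + M, by omega, hc M⟩
      · obtain ⟨M, m1, m2⟩ := first_dev hαρ0 e
        have hNM : N ≤ M := by
          by_contra h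
          exact m2 (hd _ (by omega))
        have ho' : G.owner (α M) ≠ i := fun h => m2 (hα.own_agree hf m1 h)
        obtain ⟨a, ha⟩ := hα.isRun M
        apply hσl
        apply P1 α (M + 1) hα hαρ0 (fun h => m2 (h _ le_rfl))
        rw [← ha]
        apply val_opp G i hm ho'
        rw [m1 M le_rfl]
        have := hc (M - N)
        rwa [show N + (M - N) = M by omega] at this
    · exact hσl (P1 α N hα hαρ0 hd hv)
  have hvz : G.val i (α N) = 0 := by
    rcases val_cases G i (α N) with h | h | h <;> omega
  obtain ⟨α', a1, a2, a3⟩ :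
      ∃ α', Cons G.toArena i f α' ∧ (∀ k ≤ N, α' k = α k) ∧ α' ∈ G.obj i := by
    by_cases hd : ∀ k ≤ N, α k = ρ k
    · obtain ⟨γ, g1, g2, g3⟩ := hwinρ N (by rw [← hd N le_rfl]; exact hvz)
      exact ⟨γ, g1, fun k hk => (g2 k hk).trans (hd k hk).symm, g3⟩
    · exact P2 α N hα hαρ0 hd hv0
  have hβv : G.val i (β (N + 1)) ≠ 1 := by
    intro h
    obtain ⟨b, hb⟩ := hβ.isRun N
    rw [← hb, ← hag N le_rfl] at h
    exact hv1 (val_own G i hm ho h)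
  obtain ⟨β', b1, b2, b3⟩ := exists_losing G i hm hβ hβv
  have hα'n : α' (N + 1) = α (N + 1) :=
    a1.own_agree hα a2 (by rw [a2 N le_rfl]; exact ho)
  obtain ⟨σ', s1, s2⟩ := joint_profile i f τ G.init α' β' a1 b1
    ((a2 0 (by omega)).trans hα0) ((b2 0 (by omega)).trans hβ0) (by
      intro n hn hon
      rcases Nat.lt_trichotomy n N with h | h | h
      · rw [a2 _ h, b2 _ (by omega), hag _ h]
      · subst h
        rw [a2 n le_rfl] at hon
        exact absurd ho hon
      · exfalso
        apply hne
        rw [← hα'n, hn (N + 1) h, b2 _ le_rfl])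
  have := hdom σ'
  unfold Arena.outcome at this
  rw [s1, s2] at this
  exact b3 (this a3)

end Back

end Stmt19

/-- characterization of the outcomes of profiles in which player `i`
plays an admissible strategy: `Out_G ∩ Φ_i = Out_G(Adm_i, Σ_{-i})`. -/
theorem stmt19 {ι : Type} [DecidableEq ι] (G : Game ι) [Finite G.toArena.State]
    (hm : G.IsMuller) (i : ι) :
    G.OutAll ∩ G.Phi i =
      {ρ | ∃ σ : G.toArena.Profile, G.Admissible i (σ i) ∧ G.toArena.outcome σ = ρ} := by
  ext ρ
  constructor
  · rintro ⟨⟨σ, rfl⟩, hP⟩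
    have : Nonempty G.Act := ⟨σ i []⟩
    obtain ⟨f, hf, hadm⟩ := Stmt19.phi_adm i hm (Stmt19.outcome_cons σ i G.init).isRun rfl hP
    obtain ⟨σ', hσ'⟩ := Stmt19.cons_profile i f G.init _ hf rfl
    exact ⟨Function.update σ' i f, by rwa [Function.update_self], hσ'⟩
  · rintro ⟨σ, hadm, rfl⟩
    have : Nonempty G.Act := ⟨σ i []⟩
    exact ⟨⟨σ, rfl⟩, Stmt19.adm_phi i hm hadm (Stmt19.outcome_cons σ i G.init) rfl⟩
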